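/- arXiv:1909.02773 — 2 statements merged into one kernel-verified Lean document; each statement's English description precedes it below -/
import Mathlib

section
/- Suppose G is bipartite (2-colorable), let J be a join of G of maximum cardinality |J| = μ(G), and let e ∈ J. Then μ(G) is the least natural number k with the property that every monomial of degree k in K[E_G] belongs to the ideal I(X_G) + (t_e). (This is a regularity-free formulation of the equality reg I(X_G) = μ(G) for bipartite graphs.) -/
open MvPolynomial

/-- The polynomial `x_i * x_j` associated to an edge `e = {i, j}`. -/
noncomputable def edgePoly {V : Type} (K : Type) [CommRing K] (e : Sym2 V) :
    MvPolynomial V K :=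
  Sym2.lift ⟨fun i j => X i * X j, fun _ _ => mul_comm _ _⟩ e

/-- The map `θ : K[E_G] → K[V_G]`, sending `t_e` to `x_i * x_j` for `e = {i, j}`. -/
noncomputable def thetaG {V : Type} (K : Type) [CommRing K] (G : SimpleGraph V) :
    MvPolynomial G.edgeSet K →ₐ[K] MvPolynomial V K :=
  aeval fun e => edgePoly K (e : Sym2 V)

/-- The ideal `J_V = (x_i² - x_j² : i, j ∈ V)` of `K[V_G]`. -/
noncomputable def JV (V K : Type) [CommRing K] : Ideal (MvPolynomial V K) :=
  Ideal.span {f | ∃ i j : V, f = X i ^ 2 - X j ^ 2}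

/-- The ideal `I(X_G) = θ⁻¹(J_V)` of `K[E_G]`. -/
noncomputable def IX {V : Type} (K : Type) [CommRing K] (G : SimpleGraph V) :
    Ideal (MvPolynomial G.edgeSet K) :=
  Ideal.comap (thetaG K G) (JV V K)

/-- A join of `G`: a set of edges `J ⊆ E_G` such that for every circuit `C` of `G`
(a closed walk of positive length with no repeated edges), `|J ∩ E_C| ≤ |E_C| / 2`. -/
def IsJoin {V : Type} [DecidableEq V] (G : SimpleGraph V) (J : Finset (Sym2 V)) : Prop :=
  ↑J ⊆ G.edgeSet ∧
    ∀ (v : V) (w : G.Walk v v), w.IsCircuit →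
      2 * (J ∩ w.edges.toFinset).card ≤ w.edges.toFinset.card

/-- The incidence vector of an edge, with entries modulo two. -/
def incVec {V : Type} [DecidableEq V] (e : Sym2 V) : V → ZMod 2 :=
  fun v => if v ∈ e then 1 else 0

/-- The vector of vertex degrees modulo two of a finite set of edges. -/
def edgeBoundary {V : Type} [DecidableEq V] (S : Finset (Sym2 V)) : V → ZMod 2 :=
  ∑ e ∈ S, incVec e

theorem sum_symmDiff_add_two_nsmul_sum_inter {ι M : Type*} [DecidableEq ι] [AddCommMonoid M]
    (S T : Finset ι) (f : ι → M) :
    ∑ i ∈ symmDiff S T, f i + 2 • ∑ i ∈ S ∩ T, f i = ∑ i ∈ S, f i + ∑ i ∈ T, f i := by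
  have h : Disjoint (S \ T) (T \ S) := disjoint_sdiff_sdiff
  rw [symmDiff_def, Finset.sup_eq_union, Finset.sum_union h,
    ← Finset.sum_inter_add_sum_sdiff S T f, ← Finset.sum_inter_add_sum_sdiff T S f,
    Finset.inter_comm T S, two_nsmul]
  abel

theorem card_symmDiff_add_two_mul_card_inter {ι : Type*} [DecidableEq ι] (S T : Finset ι) :
    (symmDiff S T).card + 2 * (S ∩ T).card = S.card + T.card := by
  simpa using sum_symmDiff_add_two_nsmul_sum_inter S T (fun _ => (1 : ℕ))

theorem two_nsmul_eq_zero_of_zmod_two {V : Type*} (x : V → ZMod 2) : 2 • x = 0 := by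
  ext v
  simp [CharTwo.two_eq_zero]

section

variable {V : Type} [DecidableEq V]

theorem edgeBoundary_symmDiff (S T : Finset (Sym2 V)) :
    edgeBoundary (symmDiff S T) = edgeBoundary S + edgeBoundary T := by
  have h := sum_symmDiff_add_two_nsmul_sum_inter S T incVec
  rwa [two_nsmul_eq_zero_of_zmod_two, add_zero] at h

theorem incVec_mk {a b : V} (hab : a ≠ b) :
    incVec s(a, b) = Pi.single a 1 + Pi.single b 1 := by
  ext v
  simp only [incVec, Sym2.mem_iff, Pi.add_apply, Pi.single_apply]
  split_ifs <;> simp_all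

theorem sum_incVec_mk {a b : V} (hab : a ≠ b) (A : Finset V) :
    ∑ v ∈ A, incVec s(a, b) v = (if a ∈ A then 1 else 0) + (if b ∈ A then 1 else 0) := by
  simp [incVec_mk hab, Finset.sum_add_distrib, Pi.single_apply, eq_comm]

theorem sum_edgeBoundary (S : Finset (Sym2 V)) (A : Finset V) :
    ∑ v ∈ A, edgeBoundary S v = ∑ e ∈ S, ∑ v ∈ A, incVec e v := by
  simp only [edgeBoundary, Finset.sum_apply]
  exact Finset.sum_comm

variable {G : SimpleGraph V}

theorem SimpleGraph.Walk.sum_incVec_edges {u v : V} (w : G.Walk u v) :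
    (w.edges.map incVec).sum = Pi.single u 1 + Pi.single v 1 := by
  induction w with
  | nil =>
    rw [← two_nsmul, two_nsmul_eq_zero_of_zmod_two]
    simp
  | @cons a b c h p ih =>
    have h2 := two_nsmul_eq_zero_of_zmod_two (Pi.single b 1 : V → ZMod 2)
    rw [two_nsmul] at h2
    rw [SimpleGraph.Walk.edges_cons, List.map_cons, List.sum_cons, ih, incVec_mk h.ne,
      add_assoc, ← add_assoc (Pi.single b 1), h2, zero_add]

theorem SimpleGraph.Walk.IsCircuit.edgeBoundary_eq_zero {v : V} {w : G.Walk v v}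
    (hw : w.IsCircuit) : edgeBoundary w.edges.toFinset = 0 := by
  rw [edgeBoundary, List.sum_toFinset _ hw.isTrail.edges_nodup, w.sum_incVec_edges, ← two_nsmul,
    two_nsmul_eq_zero_of_zmod_two]

theorem exists_isCircuit_of_edgeBoundary_eq_zero [Fintype V] {S : Finset (Sym2 V)}
    (hS : (S : Set (Sym2 V)) ⊆ G.edgeSet) (hne : S.Nonempty) (h0 : edgeBoundary S = 0) :
    ∃ (v : V) (w : G.Walk v v), w.IsCircuit ∧ w.edges.toFinset ⊆ S := by
  classical
  obtain ⟨e, he⟩ := hne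
  induction e with
  | _ a b =>
  let H := SimpleGraph.fromEdgeSet (S : Set (Sym2 V))
  have hadj : ∀ {x y}, s(x, y) ∈ S → G.Adj x y := fun h => hS (Finset.mem_coe.2 h)
  have hH : ∀ {x y}, H.Adj x y ↔ s(x, y) ∈ S := fun {x y} => by
    simpa [H] using fun h => (hadj h).ne
  have hle : H ≤ G := fun x y h => hadj (hH.1 h)
  by_cases hr : (H.deleteEdges {s(a, b)}).Reachable a b
  · obtain ⟨u, p, hp, -⟩ :=
      SimpleGraph.adj_and_reachable_delete_edges_iff_exists_cycle.1 ⟨hH.2 he, hr⟩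
    refine ⟨u, p.mapLe hle, (hp.mapLe hle).isCircuit, fun f hf => ?_⟩
    rw [List.mem_toFinset, SimpleGraph.Walk.edges_mapLe_eq_edges] at hf
    have := p.edges_subset_edgeSet hf
    rw [SimpleGraph.edgeSet_fromEdgeSet] at this
    exact this.1
  · exfalso
    let A : Finset V := {v | (H.deleteEdges {s(a, b)}).Reachable a v}
    have h1 := sum_edgeBoundary S A
    rw [h0, Finset.sum_eq_single_of_mem _ he, sum_incVec_mk (hadj he).ne] at h1
    · simp [A, hr] at h1
    · intro f hf hfe
      induction f with
      | _ x y =>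
      rw [sum_incVec_mk (hadj hf).ne]
      have hxy : (H.deleteEdges {s(a, b)}).Adj x y := by
        rw [SimpleGraph.deleteEdges_adj]
        exact ⟨hH.2 hf, hfe⟩
      have : x ∈ A ↔ y ∈ A := by
        simp only [A, Finset.mem_filter, Finset.mem_univ, true_and]
        exact ⟨fun h => h.trans hxy.reachable, fun h => h.trans hxy.symm.reachable⟩
      simp only [this, ← two_mul, CharTwo.two_eq_zero, zero_mul]

theorem IsJoin.two_mul_card_inter_le [Fintype V] {U : Finset (Sym2 V)} (hU : IsJoin G U)
    {C : Finset (Sym2 V)} (hC : (C : Set (Sym2 V)) ⊆ G.edgeSet) (h0 : edgeBoundary C = 0) :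
    2 * (U ∩ C).card ≤ C.card := by
  induction C using Finset.strongInduction with
  | H C ih =>
  obtain rfl | hne := C.eq_empty_or_nonempty
  · simp
  obtain ⟨v, w, hw, hwC⟩ := exists_isCircuit_of_edgeBoundary_eq_zero hC hne h0
  set D := w.edges.toFinset with hD
  have hD_ne : D.Nonempty := by
    rw [hD, List.toFinset_nonempty_iff]
    simpa [SimpleGraph.Walk.edges_eq_nil] using hw.not_nil
  have hCD : edgeBoundary (C \ D) = 0 := by
    have := edgeBoundary_symmDiff C D
    rwa [h0, hw.edgeBoundary_eq_zero, add_zero, symmDiff_of_ge hwC] at this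
  have h1 := ih (C \ D) (Finset.sdiff_ssubset hwC hD_ne)
    (fun f hf => hC (Finset.mem_coe.2 (Finset.mem_sdiff.1 hf).1)) hCD
  have h2 := hU.2 v w hw
  rw [← hD] at h2
  have h3 := Finset.card_sdiff_add_card_eq_card hwC
  have h4 : (U ∩ C).card ≤ (U ∩ (C \ D)).card + (U ∩ D).card := by
    refine (Finset.card_le_card fun f hf => ?_).trans (Finset.card_union_le _ _)
    simp only [Finset.mem_union, Finset.mem_inter, Finset.mem_sdiff] at hf ⊢
    tauto
  omega

/-- A join has the least cardinality among the edge sets with the same boundary. -/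
theorem IsJoin.card_le [Fintype V] {U T : Finset (Sym2 V)} (hU : IsJoin G U)
    (hT : (T : Set (Sym2 V)) ⊆ G.edgeSet) (h : edgeBoundary T = edgeBoundary U) :
    U.card ≤ T.card := by
  have hC : ((symmDiff U T : Finset (Sym2 V)) : Set (Sym2 V)) ⊆ G.edgeSet := fun f hf => by
    rcases Finset.mem_symmDiff.1 (Finset.mem_coe.1 hf) with hf | hf
    · exact hU.1 (Finset.mem_coe.2 hf.1)
    · exact hT (Finset.mem_coe.2 hf.1)
  have h0 : edgeBoundary (symmDiff U T) = 0 := by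
    rw [edgeBoundary_symmDiff, h, ← two_nsmul, two_nsmul_eq_zero_of_zmod_two]
  have h1 := hU.two_mul_card_inter_le hC h0
  have h2 := card_symmDiff_add_two_mul_card_inter U (symmDiff U T)
  rw [symmDiff_symmDiff_cancel_left] at h2
  omega

theorem exists_card_lt_of_not_isJoin {U : Finset (Sym2 V)}
    (hUG : (U : Set (Sym2 V)) ⊆ G.edgeSet) (hU : ¬ IsJoin G U) :
    ∃ T : Finset (Sym2 V), (T : Set (Sym2 V)) ⊆ G.edgeSet ∧ edgeBoundary T = edgeBoundary U ∧
      T.card < U.card := by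
  simp only [IsJoin, hUG, true_and, not_forall, not_le] at hU
  obtain ⟨v, w, hw, hlt⟩ := hU
  refine ⟨symmDiff U w.edges.toFinset, fun f hf => ?_, ?_, ?_⟩
  · rcases Finset.mem_symmDiff.1 (Finset.mem_coe.1 hf) with hf | hf
    · exact hUG (Finset.mem_coe.2 hf.1)
    · exact w.edges_subset_edgeSet (List.mem_toFinset.1 hf.1)
  · rw [edgeBoundary_symmDiff, hw.edgeBoundary_eq_zero, add_zero]
  · have := card_symmDiff_add_two_mul_card_inter U w.edges.toFinset
    omega

theorem IsJoin.mono {U S : Finset (Sym2 V)} (hU : IsJoin G U) (h : S ⊆ U) : IsJoin G S :=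
  ⟨fun _ hf => hU.1 (h hf), fun v w hw => le_trans
    (Nat.mul_le_mul_left 2 (Finset.card_le_card (Finset.inter_subset_inter_right h)))
    (hU.2 v w hw)⟩

theorem card_mod_two_eq_of_edgeBoundary_eq [Fintype V] (hG : G.Colorable 2)
    {S T : Finset (Sym2 V)} (hS : (S : Set (Sym2 V)) ⊆ G.edgeSet)
    (hT : (T : Set (Sym2 V)) ⊆ G.edgeSet) (h : edgeBoundary S = edgeBoundary T) :
    S.card % 2 = T.card % 2 := by
  obtain ⟨c⟩ := hG
  have key : ∀ R : Finset (Sym2 V), (R : Set (Sym2 V)) ⊆ G.edgeSet →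
      (R.card : ZMod 2) = ∑ v ∈ {v | c v = 0}, edgeBoundary R v := by
    intro R hR
    rw [sum_edgeBoundary, Finset.card_eq_sum_ones, Nat.cast_sum]
    refine Finset.sum_congr rfl fun f hf => ?_
    induction f with
    | _ x y =>
    have hxy : G.Adj x y := hR (Finset.mem_coe.2 hf)
    have hc := c.valid hxy
    rw [sum_incVec_mk hxy.ne]
    simp only [Finset.mem_filter, Finset.mem_univ, true_and]
    generalize c x = i at *
    generalize c y = j at *
    fin_cases i <;> fin_cases j <;> simp_all
  rw [← ZMod.natCast_eq_natCast_iff', key S hS, key T hT, h]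

end

theorem exists_thetaG_monomial_eq {V K : Type} [Field K] {G : SimpleGraph V} (α : G.edgeSet →₀ ℕ) :
    ∃ β : V →₀ ℕ, thetaG K G (monomial α 1) = monomial β 1 := by
  suffices thetaG K G (monomial α 1) ∈ MonoidHom.mrange (monomialOneHom K V) by
    obtain ⟨β, hβ⟩ := this
    exact ⟨β.toAdd, hβ.symm⟩
  rw [thetaG, aeval_monomial, map_one, one_mul]
  refine Submonoid.prod_mem _ fun e _ => Submonoid.pow_mem _ ?_ _
  induction (e : Sym2 V) with
  | _ a b => exact Submonoid.mul_mem _ ⟨.ofAdd (.single a 1), rfl⟩ ⟨.ofAdd (.single b 1), rfl⟩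

theorem monomial_sub_mem_JV {V K : Type} [Field K] [Fintype V] {β γ : V →₀ ℕ}
    (hdeg : ∑ v, β v = ∑ v, γ v) (hpar : ∀ v, β v % 2 = γ v % 2) :
    monomial β (1 : K) - monomial γ 1 ∈ JV V K := by
  obtain hV | ⟨⟨o⟩⟩ := isEmpty_or_nonempty V
  · rw [Subsingleton.elim β γ, sub_self]
    exact zero_mem _
  rw [← Ideal.Quotient.eq]
  set q := Ideal.Quotient.mk (JV V K)
  have hq : ∀ v, q (X v) ^ 2 = q (X o) ^ 2 := fun v => by
    rw [← map_pow, ← map_pow]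
    exact Ideal.Quotient.eq.2 (Ideal.subset_span ⟨v, o, rfl⟩)
  have key : ∀ δ : V →₀ ℕ, q (monomial δ 1) =
      (∏ v, q (X v) ^ (δ v % 2)) * (q (X o) ^ 2) ^ ∑ v, δ v / 2 := by
    intro δ
    rw [monomial_eq, map_one, one_mul, Finsupp.prod_fintype _ _ fun _ => pow_zero _, map_prod,
      ← Finset.prod_pow_eq_pow_sum, ← Finset.prod_mul_distrib]
    refine Finset.prod_congr rfl fun v _ => ?_
    rw [← hq v, ← pow_mul, ← pow_add, Nat.mod_add_div, map_pow]
  have hhalf : ∀ δ : V →₀ ℕ, ∑ v, δ v = ∑ v, δ v % 2 + 2 * ∑ v, δ v / 2 := fun δ => by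
    rw [Finset.mul_sum, ← Finset.sum_add_distrib]
    simp only [Nat.mod_add_div]
  have h1 := hhalf β
  have h2 := hhalf γ
  simp only [hpar] at h1
  rw [key, key]
  simp only [hpar]
  congr 2
  omega

section

variable {V : Type} [DecidableEq V]

theorem prod_addMonoidAlgebra_single {ι M R : Type*} [AddCommMonoid M] [CommSemiring R]
    (s : Finset ι) (f : ι → M) :
    ∏ i ∈ s, AddMonoidAlgebra.single (f i) (1 : R) = AddMonoidAlgebra.single (∑ i ∈ s, f i) 1 := by
  classical
  induction s using Finset.induction_on with
  | empty => simp [AddMonoidAlgebra.one_def]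
  | insert a s ha ih =>
    rw [Finset.prod_insert ha, Finset.sum_insert ha, ih, AddMonoidAlgebra.single_mul_single,
      mul_one]

/-- The grading of `K[V_G]` by the total degree and the exponents modulo two, as an algebra
homomorphism to a monoid algebra. -/
noncomputable def parityHom (V K : Type) [DecidableEq V] [CommRing K] :
    MvPolynomial V K →ₐ[K] AddMonoidAlgebra K (ℕ × (V → ZMod 2)) :=
  aeval fun v => AddMonoidAlgebra.single (1, Pi.single v 1) 1

variable {K : Type} [Field K] {G : SimpleGraph V}

theorem parityHom_X_sq (v : V) :
    parityHom V K (X v ^ 2) = AddMonoidAlgebra.single (2, 0) 1 := by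
  rw [map_pow, parityHom, aeval_X, AddMonoidAlgebra.single_pow, Prod.smul_mk,
    two_nsmul_eq_zero_of_zmod_two, one_pow, smul_eq_mul, mul_one]

theorem parityHom_monomial [Fintype V] (β : V →₀ ℕ) :
    parityHom V K (monomial β 1) =
      AddMonoidAlgebra.single (∑ v, β v, fun v => (β v : ZMod 2)) 1 := by
  rw [parityHom, aeval_monomial, map_one, one_mul, Finsupp.prod_fintype _ _ fun _ => pow_zero _]
  simp only [AddMonoidAlgebra.single_pow, one_pow, prod_addMonoidAlgebra_single]
  congr 1
  ext v
  · simp [Prod.fst_sum]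
  · simp [Prod.snd_sum, Finset.sum_apply, Pi.single_apply]

theorem parityHom_eq_zero_of_mem_JV {f : MvPolynomial V K} (hf : f ∈ JV V K) :
    parityHom V K f = 0 := by
  suffices JV V K ≤ RingHom.ker (parityHom V K) from this hf
  rw [JV, Ideal.span_le]
  rintro _ ⟨i, j, rfl⟩
  rw [SetLike.mem_coe, RingHom.mem_ker, map_sub, parityHom_X_sq, parityHom_X_sq, sub_self]

/-- The vertex degrees modulo two of the multiset of edges given by an exponent vector. -/
noncomputable def expBoundary : (G.edgeSet →₀ ℕ) →+ (V → ZMod 2) :=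
  Finsupp.liftAddHom fun e => multiplesHom _ (incVec (e : Sym2 V))

theorem expBoundary_apply (α : G.edgeSet →₀ ℕ) :
    expBoundary α = α.sum fun e m => m • incVec (e : Sym2 V) :=
  rfl

theorem expBoundary_single (e : G.edgeSet) (n : ℕ) :
    expBoundary (Finsupp.single e n) = n • incVec (e : Sym2 V) := by
  rw [expBoundary_apply]
  exact Finsupp.sum_single_index (zero_nsmul _)

theorem parityHom_edgePoly (e : G.edgeSet) :
    parityHom V K (edgePoly K (e : Sym2 V)) =
      AddMonoidAlgebra.single (2, incVec (e : Sym2 V)) 1 := by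
  obtain ⟨e, he⟩ := e
  induction e with
  | _ a b =>
  have hab : G.Adj a b := he
  simp only [edgePoly, Sym2.lift_mk, map_mul, parityHom, aeval_X,
    AddMonoidAlgebra.single_mul_single, mul_one, incVec_mk hab.ne, Prod.mk_add_mk]

theorem parityHom_thetaG_monomial (α : G.edgeSet →₀ ℕ) (c : K) :
    parityHom V K (thetaG K G (monomial α c)) =
      AddMonoidAlgebra.single (2 * α.degree, expBoundary α) c := by
  rw [thetaG, aeval_monomial, map_mul, AlgHom.commutes, map_finsuppProd]
  simp only [map_pow, parityHom_edgePoly, AddMonoidAlgebra.single_pow, one_pow, Finsupp.prod,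
    prod_addMonoidAlgebra_single]
  rw [AddMonoidAlgebra.coe_algebraMap, Function.comp_apply, AddMonoidAlgebra.single_mul_single,
    zero_add, Algebra.algebraMap_self_apply, mul_one]
  congr 1
  ext v
  · simp [Prod.fst_sum, Finsupp.degree_apply, Finset.mul_sum, mul_comm]
  · simp [Prod.snd_sum, expBoundary_apply, Finsupp.sum]

theorem monomial_sub_mem_IX [Fintype V] {α γ : G.edgeSet →₀ ℕ} (hdeg : α.degree = γ.degree)
    (hpar : expBoundary α = expBoundary γ) :
    monomial α (1 : K) - monomial γ 1 ∈ IX K G := by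
  obtain ⟨a, ha⟩ := exists_thetaG_monomial_eq (K := K) α
  obtain ⟨c, hc⟩ := exists_thetaG_monomial_eq (K := K) γ
  have h : parityHom V K (monomial a 1) = parityHom V K (monomial c 1) := by
    rw [← ha, ← hc, parityHom_thetaG_monomial, parityHom_thetaG_monomial, hdeg, hpar]
  rw [parityHom_monomial, parityHom_monomial] at h
  have h' := AddMonoidAlgebra.single_left_injective (one_ne_zero (α := K)) h
  rw [Prod.mk.injEq] at h'
  rw [IX, Ideal.mem_comap, map_sub, ha, hc]
  exact monomial_sub_mem_JV h'.1 fun v => (ZMod.natCast_eq_natCast_iff' _ _ _).1 (congrFun h'.2 v)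

/-- A monomial lies in `I(X_G) + (t_e)` if and only if it agrees modulo `I(X_G)` with a monomial
divisible by `t_e`. -/
theorem monomial_mem_IX_sup_span_iff [Fintype V] (α : G.edgeSet →₀ ℕ) (e : G.edgeSet) :
    monomial α (1 : K) ∈ IX K G ⊔ Ideal.span {X e} ↔
      ∃ γ : G.edgeSet →₀ ℕ, γ.degree + 1 = α.degree ∧
        expBoundary γ + incVec (e : Sym2 V) = expBoundary α := by
  have hX : (X e : MvPolynomial G.edgeSet K) = monomial (.single e 1) 1 := rfl
  have hadd : ∀ γ : G.edgeSet →₀ ℕ, (γ + .single e 1).degree = γ.degree + 1 := fun γ => by simp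
  have hbd : ∀ γ : G.edgeSet →₀ ℕ, expBoundary (γ + .single e 1) =
      expBoundary γ + incVec (e : Sym2 V) := fun γ => by
    rw [map_add, expBoundary_single, one_nsmul]
  constructor
  · intro h
    obtain ⟨g, hg, f, hf, hgf⟩ := Submodule.mem_sup.1 h
    obtain ⟨p, rfl⟩ := Ideal.mem_span_singleton'.1 hf
    have hp : p * X e = ∑ γ ∈ p.support, monomial (γ + .single e 1) (coeff γ p) := by
      conv_lhs => rw [p.as_sum, Finset.sum_mul]
      simp only [hX, monomial_mul, mul_one]
    have h1 := congrArg (fun r => parityHom V K (thetaG K G r)) hgf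
    simp only [map_add, parityHom_eq_zero_of_mem_JV (Ideal.mem_comap.1 hg), zero_add, hp, map_sum,
      parityHom_thetaG_monomial, hadd, hbd] at h1
    by_contra! hne
    have h2 := congrArg (fun r => r.coeff (2 * α.degree, expBoundary α)) h1
    simp only [AddMonoidAlgebra.coeff_sum, AddMonoidAlgebra.coeff_single, Finsupp.finsetSum_apply,
      Finsupp.single_eq_same] at h2
    rw [Finset.sum_eq_zero] at h2
    · exact zero_ne_one h2
    · intro γ _
      refine Finsupp.single_eq_of_ne fun h => ?_
      rw [Prod.mk.injEq] at h
      exact hne γ (by omega) h.2.symm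
  · rintro ⟨γ, hdeg, hpar⟩
    rw [← hadd] at hdeg
    rw [← hbd] at hpar
    rw [← sub_add_cancel (monomial α (1 : K)) (monomial (γ + .single e 1) 1)]
    refine Submodule.add_mem_sup (monomial_sub_mem_IX hdeg.symm hpar.symm) ?_
    rw [Ideal.mem_span_singleton']
    exact ⟨monomial γ 1, by rw [hX, monomial_mul, mul_one]⟩

theorem exists_edgeBoundary_eq_expBoundary (α : G.edgeSet →₀ ℕ) :
    ∃ S : Finset (Sym2 V), (S : Set (Sym2 V)) ⊆ G.edgeSet ∧ edgeBoundary S = expBoundary α ∧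
      S.card ≤ α.degree ∧ S.card % 2 = α.degree % 2 := by
  induction α using Finsupp.induction_linear with
  | zero => exact ⟨∅, by simp, by simp [edgeBoundary], by simp, by simp⟩
  | add α β hα hβ =>
    obtain ⟨S, hSG, hS, hScard, hSpar⟩ := hα
    obtain ⟨T, hTG, hT, hTcard, hTpar⟩ := hβ
    have h := card_symmDiff_add_two_mul_card_inter S T
    refine ⟨symmDiff S T, fun f hf => ?_, ?_, ?_, ?_⟩
    · rcases Finset.mem_symmDiff.1 (Finset.mem_coe.1 hf) with hf | hf
      · exact hSG (Finset.mem_coe.2 hf.1)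
      · exact hTG (Finset.mem_coe.2 hf.1)
    · rw [edgeBoundary_symmDiff, hS, hT, map_add]
    · rw [map_add]
      omega
    · rw [map_add]
      omega
  | single e n =>
    rw [expBoundary_single, Finsupp.degree_single]
    obtain ⟨m, rfl | rfl⟩ := Nat.even_or_odd' n
    · refine ⟨∅, by simp, ?_, by simp, by simp⟩
      rw [mul_nsmul, two_nsmul_eq_zero_of_zmod_two, nsmul_zero, edgeBoundary, Finset.sum_empty]
    · refine ⟨{(e : Sym2 V)}, by simp, ?_, by simp, by simp⟩
      rw [add_nsmul, mul_nsmul, two_nsmul_eq_zero_of_zmod_two, nsmul_zero, zero_add, one_nsmul,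
        edgeBoundary, Finset.sum_singleton]

theorem exists_expBoundary_eq_edgeBoundary {S : Finset (Sym2 V)}
    (hS : (S : Set (Sym2 V)) ⊆ G.edgeSet) :
    ∃ α : G.edgeSet →₀ ℕ, expBoundary α = edgeBoundary S ∧ α.degree = S.card := by
  refine ⟨∑ f ∈ S.attach, .single ⟨f, hS f.2⟩ 1, ?_, by simp⟩
  simp only [map_sum, expBoundary_single, one_nsmul, edgeBoundary]
  exact S.sum_attach incVec

end

/-- If `G` is bipartite, `J` is a join of maximum cardinality `μ(G)`, and `e ∈ J`, then
`μ(G)` is the least `k` such that every monomial of degree `k` in `K[E_G]` belongs to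
`I(X_G) + (t_e)`.  (A regularity-free form of `reg I(X_G) = μ(G)` for bipartite `G`.) -/
theorem stmt15 {V K : Type} [Fintype V] [DecidableEq V] [Field K] (G : SimpleGraph V)
    (hG : ∀ v : V, ∃ w : V, G.Adj v w) (hbip : G.Colorable 2)
    (μ : ℕ)
    (hμ : IsGreatest {n : ℕ | ∃ J : Finset (Sym2 V), IsJoin G J ∧ J.card = n} μ)
    (J : Finset (Sym2 V)) (hJ : IsJoin G J) (hJcard : J.card = μ)
    (e : Sym2 V) (he : e ∈ J) :
    IsLeast {k : ℕ | ∀ α : G.edgeSet →₀ ℕ, (α.sum fun _ m => m) = k →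
      (monomial α (1 : K) : MvPolynomial G.edgeSet K) ∈
        IX K G ⊔ Ideal.span {X (⟨e, hJ.1 (Finset.mem_coe.mpr he)⟩ : G.edgeSet)}} μ := by
  have heG : e ∈ G.edgeSet := hJ.1 (Finset.mem_coe.mpr he)
  have hpos : 0 < J.card := Finset.card_pos.2 ⟨e, he⟩
  have hsum : ∀ α : G.edgeSet →₀ ℕ, (α.sum fun _ m => m) = α.degree := fun α => rfl
  have hsing : edgeBoundary {e} = incVec e := Finset.sum_singleton _ _
  have hee : incVec e + incVec e = 0 := by rw [← two_nsmul, two_nsmul_eq_zero_of_zmod_two]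
  constructor
  · intro α hα
    rw [hsum] at hα
    rw [monomial_mem_IX_sup_span_iff]
    obtain ⟨S, hSG, hS, hScard, hSpar⟩ := exists_edgeBoundary_eq_expBoundary α
    have hUG : ((symmDiff S {e} : Finset (Sym2 V)) : Set (Sym2 V)) ⊆ G.edgeSet := fun f hf => by
      rcases Finset.mem_symmDiff.1 (Finset.mem_coe.1 hf) with hf | hf
      · exact hSG (Finset.mem_coe.2 hf.1)
      · rwa [Finset.mem_singleton.1 hf.1]
    have hcard := card_symmDiff_add_two_mul_card_inter S {e}
    rw [Finset.card_singleton] at hcard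
    obtain ⟨T, hTG, hT, hTcard, hTpar⟩ : ∃ T : Finset (Sym2 V),
        (T : Set (Sym2 V)) ⊆ G.edgeSet ∧ edgeBoundary T = edgeBoundary (symmDiff S {e}) ∧
          T.card < μ ∧ (T.card + 1) % 2 = μ % 2 := by
      by_cases hlt : (symmDiff S {e}).card < μ
      · exact ⟨symmDiff S {e}, hUG, rfl, hlt, by omega⟩
      · have hU : ¬ IsJoin G (symmDiff S {e}) := fun hU => by
          have := hμ.2 ⟨_, hU, rfl⟩
          omega
        obtain ⟨T, hTG, hT, hTcard⟩ := exists_card_lt_of_not_isJoin hUG hU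
        have := card_mod_two_eq_of_edgeBoundary_eq hbip hTG hUG hT
        exact ⟨T, hTG, hT, by omega, by omega⟩
    obtain ⟨β, hβ, hβdeg⟩ := exists_expBoundary_eq_edgeBoundary hTG
    obtain ⟨m, hm⟩ : ∃ m, μ = T.card + 1 + 2 * m := ⟨(μ - (T.card + 1)) / 2, by omega⟩
    refine ⟨β + .single ⟨e, heG⟩ (2 * m), ?_, ?_⟩
    · rw [map_add, Finsupp.degree_single]
      omega
    · rw [map_add, expBoundary_single, mul_nsmul, two_nsmul_eq_zero_of_zmod_two, nsmul_zero,
        add_zero, hβ, hT, edgeBoundary_symmDiff, hsing, hS, add_assoc, hee, add_zero]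
  · intro k hk
    by_contra! hlt
    obtain ⟨S, hSJ, hScard⟩ := Finset.exists_subset_card_eq (s := J.erase e) (n := k)
      (by rw [Finset.card_erase_of_mem he]; omega)
    have heS : e ∉ S := fun h => Finset.notMem_erase e J (hSJ h)
    have hU : IsJoin G (insert e S) :=
      hJ.mono (Finset.insert_subset he (hSJ.trans (Finset.erase_subset _ _)))
    obtain ⟨α, hα, hαdeg⟩ := exists_expBoundary_eq_edgeBoundary
      (hU.mono (Finset.subset_insert e S)).1
    obtain ⟨γ, hγdeg, hγ⟩ := (monomial_mem_IX_sup_span_iff α _).1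
      (hk α ((hsum α).trans (hαdeg.trans hScard)))
    obtain ⟨T, hTG, hT, hTcard, -⟩ := exists_edgeBoundary_eq_expBoundary γ
    have hTU : edgeBoundary T = edgeBoundary (insert e S) := by
      rw [hT, edgeBoundary, Finset.sum_insert heS, ← edgeBoundary, ← hα, ← hγ, add_left_comm, hee,
        add_zero]
    have := hU.card_le hTG hTU
    rw [Finset.card_insert_of_notMem heS] at this
    omega
end

section
/- Suppose G is not bipartite (not 2-colorable) and let b0(G) denote the number of connected components of G. Then for every edge e ∈ E_G, every homogeneous polynomial f ∈ K[E_G] of degree |V_G| − b0(G) + 1 belongs to the ideal I(X_G) + (t_e). (This is a regularity-free formulation of the bound reg I(X_G) ≤ |V_G| − b0(G) + 1 for non-bipartite graphs.) -/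
open MvPolynomial

/-- Over `ZMod 2`, an element of the span of a family is a sum of at most as many members of the
family as the dimension of the span. -/
theorem exists_natCombination_degree_le {ι M : Type*} [AddCommGroup M] [Module (ZMod 2) M]
    [FiniteDimensional (ZMod 2) M] (v : ι → M) {w : M}
    (hw : w ∈ Submodule.span (ZMod 2) (Set.range v)) :
    ∃ b : ι →₀ ℕ, Finsupp.linearCombination ℕ v b = w ∧
      b.degree ≤ Module.finrank (ZMod 2) (Submodule.span (ZMod 2) (Set.range v)) := by
  obtain ⟨κ, a, -, hspan, hli⟩ := exists_linearIndependent' (ZMod 2) v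
  have : Finite κ := hli.finite
  have : Fintype κ := Fintype.ofFinite κ
  rw [← hspan, Submodule.mem_span_range_iff_exists_fun] at hw
  obtain ⟨c, rfl⟩ := hw
  refine ⟨∑ k, Finsupp.single (a k) (c k).val, ?_, ?_⟩
  · simp only [map_sum, Finsupp.linearCombination_single, Function.comp_apply]
    refine Finset.sum_congr rfl fun k _ => ?_
    rw [← Nat.cast_smul_eq_nsmul (ZMod 2), ZMod.natCast_zmod_val]
  · rw [← hspan, finrank_span_eq_card hli, map_sum]
    simp only [Finsupp.degree_single]
    calc ∑ k, (c k).val ≤ ∑ _k : κ, 1 :=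
          Finset.sum_le_sum fun k _ => Nat.le_of_lt_succ (ZMod.val_lt (c k))
      _ = Fintype.card κ := by simp

/-- The exponent of the monomial `x_i * x_j` associated to an edge `{i, j}`. -/
noncomputable def edgeExponent {V : Type*} (e : Sym2 V) : V →₀ ℕ :=
  Sym2.lift ⟨fun i j => Finsupp.single i 1 + Finsupp.single j 1, fun _ _ => add_comm _ _⟩ e

theorem edgePoly_eq_monomial {V K : Type} [CommRing K] (e : Sym2 V) :
    edgePoly K e = monomial (edgeExponent e) 1 := by
  induction e with
  | _ i j => simp [edgePoly, edgeExponent, X, monomial_mul]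

theorem degree_edgeExponent {V : Type*} (e : Sym2 V) : (edgeExponent e).degree = 2 := by
  induction e with
  | _ i j => simp [edgeExponent]

/-- The exponent of the image under `θ` of the monomial with exponent `a`. -/
noncomputable def vertexExponent {V : Type*} {s : Set (Sym2 V)} (a : s →₀ ℕ) : V →₀ ℕ :=
  Finsupp.linearCombination ℕ (fun e : s => edgeExponent (e : Sym2 V)) a

theorem degree_vertexExponent {V : Type*} {s : Set (Sym2 V)} (a : s →₀ ℕ) :
    (vertexExponent a).degree = 2 * a.degree := by
  simp [vertexExponent, Finsupp.linearCombination_apply, Finsupp.sum, degree_edgeExponent,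
    Finsupp.degree_apply a, Finset.mul_sum, mul_comm]

theorem thetaG_monomial {V K : Type} [CommRing K] (G : SimpleGraph V) (a : G.edgeSet →₀ ℕ)
    (c : K) : thetaG K G (monomial a c) = monomial (vertexExponent a) c := by
  simp only [thetaG, aeval_monomial, edgePoly_eq_monomial, vertexExponent,
    Finsupp.linearCombination_apply, Finsupp.prod, Finsupp.sum, monomial_pow, one_pow,
    algebraMap_eq, monomial_sum_index]

/-- Monomials of the same degree whose exponents have the same parities agree modulo `J_V`. -/
theorem monomial_sub_monomial_mem_JV {V K : Type} [Fintype V] [CommRing K] {p q : V →₀ ℕ}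
    (hdeg : p.degree = q.degree) (hpar : ∀ i, p i % 2 = q i % 2) (c : K) :
    monomial p c - monomial q c ∈ JV V K := by
  rcases isEmpty_or_nonempty V with hV | ⟨⟨o⟩⟩
  · simp [Subsingleton.elim p q]
  have hsq (i : V) : Ideal.Quotient.mk (JV V K) (X i) ^ 2 =
      Ideal.Quotient.mk (JV V K) (X o) ^ 2 := by
    rw [← map_pow, ← map_pow, Ideal.Quotient.mk_eq_mk_iff_sub_mem]
    exact Ideal.subset_span ⟨i, o, rfl⟩
  have key (r : V →₀ ℕ) : Ideal.Quotient.mk (JV V K) (monomial r c) =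
      Ideal.Quotient.mk (JV V K) (C c) *
        ((∏ i, Ideal.Quotient.mk (JV V K) (X i) ^ (r i % 2)) *
        (Ideal.Quotient.mk (JV V K) (X o) ^ 2) ^ (∑ i, r i / 2)) := by
    rw [monomial_eq, Finsupp.prod_fintype _ _ (by simp), map_mul, map_prod,
      ← Finset.prod_pow_eq_pow_sum, ← Finset.prod_mul_distrib]
    congr 1
    refine Finset.prod_congr rfl fun i _ => ?_
    rw [map_pow, ← hsq i, ← pow_mul, ← pow_add, Nat.mod_add_div]
  have hhalf : ∑ i, p i / 2 = ∑ i, q i / 2 := by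
    have hsum (r : V →₀ ℕ) : ∑ i, r i % 2 + 2 * ∑ i, r i / 2 = r.degree := by
      rw [Finset.mul_sum, ← Finset.sum_add_distrib, Finsupp.degree_eq_sum]
      exact Finset.sum_congr rfl fun i _ => Nat.mod_add_div _ _
    have hp := hsum p
    have hq := hsum q
    have hmod := Finset.sum_congr (rfl : (Finset.univ : Finset V) = _) fun i _ => hpar i
    omega
  rw [← Ideal.Quotient.mk_eq_mk_iff_sub_mem, key, key, hhalf]
  simp only [hpar]

/-- The incidence vector modulo 2 of an edge, together with an extra coordinate `1` recording the
parity of the number of edges. -/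
noncomputable def edgeVector {V : Type*} (e : Sym2 V) : (V → ZMod 2) × ZMod 2 :=
  (fun i => (edgeExponent e i : ZMod 2), 1)

theorem linearCombination_edgeVector {V : Type*} {s : Set (Sym2 V)} (a : s →₀ ℕ) :
    Finsupp.linearCombination ℕ (fun e : s => edgeVector (e : Sym2 V)) a =
      (fun i => (vertexExponent a i : ZMod 2), (a.degree : ZMod 2)) := by
  induction a using Finsupp.induction_linear with
  | zero => simp [vertexExponent]; rfl
  | add a b ha hb =>
    rw [map_add, ha, hb]
    ext <;> simp [vertexExponent]
  | single e n =>
    ext <;> simp [vertexExponent, edgeVector]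

/-- The edge vectors of a graph span a space of dimension at most `|V| - b₀(G) + 1`. -/
theorem finrank_span_edgeVector_le {V : Type*} [Fintype V] (G : SimpleGraph V) :
    Module.finrank (ZMod 2)
        (Submodule.span (ZMod 2) (Set.range fun e : G.edgeSet => edgeVector (e : Sym2 V))) ≤
      Fintype.card V - Nat.card G.ConnectedComponent + 1 := by
  classical
  have : Fintype G.ConnectedComponent := Fintype.ofFinite _
  let φ : (V → ZMod 2) →ₗ[ZMod 2] (G.ConnectedComponent → ZMod 2) :=
    Fintype.linearCombination (ZMod 2) fun i => Pi.single (G.connectedComponentMk i) 1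
  have hφ : Function.Surjective φ := by
    rw [← LinearMap.range_eq_top, Fintype.range_linearCombination, eq_top_iff,
      ← (Pi.basisFun (ZMod 2) G.ConnectedComponent).span_eq]
    refine Submodule.span_mono ?_
    rintro _ ⟨c, rfl⟩
    induction c using SimpleGraph.ConnectedComponent.ind with
    | _ i => exact ⟨i, by simp⟩
  let ψ := φ ∘ₗ LinearMap.fst (ZMod 2) (V → ZMod 2) (ZMod 2)
  have hψ : Function.Surjective ψ := hφ.comp Prod.fst_surjective
  have hle : Submodule.span (ZMod 2) (Set.range fun e : G.edgeSet => edgeVector (e : Sym2 V)) ≤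
      LinearMap.ker ψ := by
    rw [Submodule.span_le]
    rintro _ ⟨⟨e, he⟩, rfl⟩
    induction e with
    | _ i j =>
      have hij : G.connectedComponentMk i = G.connectedComponentMk j :=
        SimpleGraph.ConnectedComponent.sound (SimpleGraph.Adj.reachable he)
      have hv : (edgeVector s(i, j)).1 = Pi.single i 1 + Pi.single j 1 := by
        ext k
        simp [edgeVector, edgeExponent, Finsupp.single_apply, Pi.single_apply, eq_comm]
      change φ (edgeVector s(i, j)).1 = 0
      simp only [hv, map_add, φ, Fintype.linearCombination_apply_single, hij, one_smul]
      exact funext fun _ => CharTwo.add_self_eq_zero _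
  have hker := ψ.finrank_range_add_finrank_ker
  rw [LinearMap.range_eq_top.2 hψ, finrank_top, Module.finrank_prod, Module.finrank_self,
    Module.finrank_fintype_fun_eq_card, Module.finrank_fintype_fun_eq_card] at hker
  have hcard := Fintype.card_le_of_surjective G.connectedComponentMk Quot.mk_surjective
  have hmono := Submodule.finrank_mono hle
  rw [Nat.card_eq_fintype_card]
  omega

/-- Every exponent of degree `|V| - b₀(G) + 1` can be replaced by one containing a given edge,
without changing the degree or the parities of the vertex exponents. -/
theorem exists_exponent_containing_edge {V : Type*} [Fintype V] (G : SimpleGraph V)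
    (e : G.edgeSet) (a : G.edgeSet →₀ ℕ)
    (ha : a.degree = Fintype.card V - Nat.card G.ConnectedComponent + 1) :
    ∃ b : G.edgeSet →₀ ℕ, b.degree = a.degree ∧ b e ≠ 0 ∧
      ∀ i, vertexExponent a i % 2 = vertexExponent b i % 2 := by
  let v : G.edgeSet → (V → ZMod 2) × ZMod 2 := fun e => edgeVector (e : Sym2 V)
  have hmem : Finsupp.linearCombination ℕ v (a + Finsupp.single e 1) ∈
      Submodule.span (ZMod 2) (Set.range v) := by
    rw [Finsupp.linearCombination_apply]
    exact Submodule.sum_mem _ fun x _ =>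
      Submodule.smul_of_tower_mem _ _ (Submodule.subset_span ⟨x, rfl⟩)
  obtain ⟨b, hb, hbdeg⟩ := exists_natCombination_degree_le v hmem
  replace hbdeg := (hbdeg.trans (finrank_span_edgeVector_le G)).trans_eq ha.symm
  have hparity : b.degree % 2 = (a.degree + 1) % 2 := by
    have h := congrArg Prod.snd hb
    simp only [v, linearCombination_edgeVector] at h
    simpa using (ZMod.natCast_eq_natCast_iff' _ _ _).1 h
  refine ⟨b + Finsupp.single e (a.degree - b.degree), ?_, ?_, fun i => ?_⟩
  · simp only [map_add, Finsupp.degree_single]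
    omega
  · simp only [Finsupp.add_apply, Finsupp.single_eq_same]
    omega
  · have h := congrFun (congrArg Prod.fst hb) i
    simp only [v, linearCombination_edgeVector] at h
    replace h := (ZMod.natCast_eq_natCast_iff' _ _ _).1 h
    simp only [vertexExponent, map_add, Finsupp.linearCombination_single, Finsupp.add_apply,
      Finsupp.smul_apply, smul_eq_mul, one_mul] at h ⊢
    obtain ⟨m, hm⟩ : ∃ m, a.degree - b.degree = 2 * m + 1 :=
      ⟨(a.degree - b.degree) / 2, by omega⟩
    rw [hm, add_mul, one_mul, mul_assoc]
    omega

/-- If `G` is not bipartite and has `b₀(G)` connected components, then for any edge `e`,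
every homogeneous polynomial of degree `|V_G| - b₀(G) + 1` lies in `I(X_G) + (t_e)`.
(A regularity-free form of `reg I(X_G) ≤ |V_G| - b₀(G) + 1` for non-bipartite `G`.) -/
theorem stmt17 {V K : Type} [Fintype V] [Field K] (G : SimpleGraph V)
    (hG : ∀ v : V, ∃ w : V, G.Adj v w) (hnbip : ¬ G.Colorable 2)
    (e : Sym2 V) (he : e ∈ G.edgeSet)
    (f : MvPolynomial G.edgeSet K)
    (hf : f.IsHomogeneous (Fintype.card V - Nat.card G.ConnectedComponent + 1)) :
    f ∈ IX K G ⊔ Ideal.span {X (⟨e, he⟩ : G.edgeSet)} := by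
  rw [f.as_sum]
  refine Submodule.sum_mem _ fun a ha => ?_
  have hdeg : a.degree = Fintype.card V - Nat.card G.ConnectedComponent + 1 := by
    rw [Finsupp.degree_eq_weight_one]
    exact hf (mem_support_iff.1 ha)
  obtain ⟨b, hbdeg, hbe, hpar⟩ := exists_exponent_containing_edge G ⟨e, he⟩ a hdeg
  rw [← sub_add_cancel (monomial a (coeff a f)) (monomial b (coeff a f))]
  refine Submodule.add_mem_sup ?_ ?_
  · rw [IX, Ideal.mem_comap, map_sub, thetaG_monomial, thetaG_monomial]
    refine monomial_sub_monomial_mem_JV ?_ hpar _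
    rw [degree_vertexExponent, degree_vertexExponent, hbdeg]
  · rw [Ideal.mem_span_singleton, X_dvd_monomial]
    exact Or.inr hbe
end
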